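/- Over the class of finitely-branching Kripke trees, MPL is strictly less expressive than MTL, and MTL is strictly less expressive than MSO: MPL < MTL < MSO. -/

import Mathlib

/-! ## Trees over ℕ* -/

abbrev Node : Type := List ℕ

/-- `T` is a tree with root `r`: `r ∈ T`, every node extends `r`, and `T` is
prefix-closed above `r`. -/
def IsTreeRooted (T : Set Node) (r : Node) : Prop :=
  r ∈ T ∧ (∀ τ ∈ T, r <+: τ) ∧
    ∀ σ σ' : List ℕ, r ++ σ ∈ T → σ' <+: σ → r ++ σ' ∈ T

/-- `T ⊆ ℕ*` is a tree. -/
def IsTree (T : Set Node) : Prop := ∃ r : Node, IsTreeRooted T r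

/-- `τ'` is a child of `τ` in `T`. -/
def childIn (T : Set Node) (τ τ' : Node) : Prop := τ' ∈ T ∧ ∃ n : ℕ, τ' = τ ++ [n]

/-- every node of `T` has a child in `T`. -/
def NonBlocking (T : Set Node) : Prop := ∀ τ ∈ T, ∃ n : ℕ, τ ++ [n] ∈ T

/-- every node of `T` has finitely many children in `T`. -/
def FinBranching (T : Set Node) : Prop := ∀ τ ∈ T, {τ' : Node | childIn T τ τ'}.Finite

/-- `S` is a subtree of `T`. -/
def IsSubtree (T S : Set Node) : Prop := S ⊆ T ∧ IsTree S

/-- `P` is a path of `T`: a subtree totally ordered by the child relation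
(each node has at most one child in `P`). -/
def IsPathOf (T P : Set Node) : Prop :=
  IsSubtree T P ∧ ∀ τ ∈ P, ∀ n m : ℕ, τ ++ [n] ∈ P → τ ++ [m] ∈ P → n = m

/-- `T` is a chain: a tree in which each node has at most one child. -/
def IsChainTree (T : Set Node) : Prop :=
  IsTree T ∧ ∀ τ ∈ T, ∀ n m : ℕ, τ ++ [n] ∈ T → τ ++ [m] ∈ T → n = m

/-- `T` is dense: it contains a subtree every node of which has a descendant
in the subtree with at least two distinct children in the subtree. -/
def DenseTree (T : Set Node) : Prop :=
  ∃ S : Set Node, IsSubtree T S ∧ ∀ τ ∈ S, ∃ τ' ∈ S, τ <+: τ' ∧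
    ∃ n m : ℕ, n ≠ m ∧ τ' ++ [n] ∈ S ∧ τ' ++ [m] ∈ S

/-- A Kripke tree over `AP`: a non-blocking tree together with a labelling. -/
structure KripkeTree (AP : Type) where
  T : Set Node
  root : Node
  rooted : IsTreeRooted T root
  nonblocking : NonBlocking T
  Lab : Node → Set AP

/-! ## MSOL syntax -/

inductive MSOL (AP : Type) : Type
  | atom : AP → ℕ → MSOL AP          -- P_a(x)
  | le   : ℕ → ℕ → MSOL AP           -- x ≤ y
  | mem  : ℕ → ℕ → MSOL AP           -- x ∈ X
  | not  : MSOL AP → MSOL AP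
  | and  : MSOL AP → MSOL AP → MSOL AP
  | exFO : ℕ → MSOL AP → MSOL AP     -- ∃x. φ
  | exSO : ℕ → MSOL AP → MSOL AP     -- ∃X. φ

namespace MSOL

def freeFO {AP : Type} : MSOL AP → Set ℕ
  | atom _ x => {x}
  | le x y => {x, y}
  | mem x _ => {x}
  | not φ => φ.freeFO
  | and φ ψ => φ.freeFO ∪ ψ.freeFO
  | exFO x φ => φ.freeFO \ {x}
  | exSO _ φ => φ.freeFO

def freeSO {AP : Type} : MSOL AP → Set ℕ
  | atom _ _ => ∅
  | le _ _ => ∅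
  | mem _ X => {X}
  | not φ => φ.freeSO
  | and φ ψ => φ.freeSO ∪ ψ.freeSO
  | exFO _ φ => φ.freeSO
  | exSO X φ => φ.freeSO \ {X}

/-- A sentence is a formula with no free variables. -/
def IsSentence {AP : Type} (φ : MSOL AP) : Prop := φ.freeFO = ∅ ∧ φ.freeSO = ∅

/-- The first-order fragment: no second-order variables. -/
def IsFO {AP : Type} : MSOL AP → Prop
  | atom _ _ => True
  | le _ _ => True
  | mem _ _ => False
  | not φ => φ.IsFO
  | and φ ψ => φ.IsFO ∧ ψ.IsFO
  | exFO _ φ => φ.IsFO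
  | exSO _ _ => False

end MSOL

/-! ## MSOL semantics, parametrized by the range of second-order quantifiers -/

/-- A second-order domain: for each tree, the collection of sets that
second-order quantifiers range over. -/
abbrev SODom : Type := Set Node → Set (Set Node)

def Sat {AP : Type} (D : SODom) (K : KripkeTree AP) :
    (ℕ → Node) → (ℕ → Set Node) → MSOL AP → Prop
  | V1, _,  .atom a x => V1 x ∈ K.T ∧ a ∈ K.Lab (V1 x)
  | V1, _,  .le x y => V1 x ∈ K.T ∧ V1 y ∈ K.T ∧ V1 x <+: V1 y
  | V1, V2, .mem x X => V1 x ∈ V2 X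
  | V1, V2, .not φ => ¬ Sat D K V1 V2 φ
  | V1, V2, .and φ ψ => Sat D K V1 V2 φ ∧ Sat D K V1 V2 ψ
  | V1, V2, .exFO x φ => ∃ τ ∈ K.T, Sat D K (Function.update V1 x τ) V2 φ
  | V1, V2, .exSO X φ => ∃ S ∈ D K.T, Sat D K V1 (Function.update V2 X S) φ

/-- A logic: a syntactic fragment of MSOL together with a second-order domain. -/
structure MLogic (AP : Type) where
  syn : MSOL AP → Prop
  dom : SODom

namespace MLogic

/-- A Kripke tree satisfies a sentence. -/
def KSat {AP : Type} (L : MLogic AP) (K : KripkeTree AP) (φ : MSOL AP) : Prop :=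
  ∃ V1 V2, Sat L.dom K V1 V2 φ

/-- `L ≤ L'` over the class `M`. -/
def Leq {AP : Type} (M : Set (KripkeTree AP)) (L L' : MLogic AP) : Prop :=
  ∀ φ : MSOL AP, φ.IsSentence → L.syn φ →
    ∃ φ' : MSOL AP, φ'.IsSentence ∧ L'.syn φ' ∧
      ∀ K ∈ M, (L.KSat K φ ↔ L'.KSat K φ')

/-- `L < L'` over the class `M`. -/
def Lt {AP : Type} (M : Set (KripkeTree AP)) (L L' : MLogic AP) : Prop :=
  Leq M L L' ∧ ¬ Leq M L' L

/-- `L ≡ L'` over the class `M`. -/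
def EquivExp {AP : Type} (M : Set (KripkeTree AP)) (L L' : MLogic AP) : Prop :=
  Leq M L L' ∧ Leq M L' L

/-- `L` and `L'` are expressively incomparable over the class `M`. -/
def Incomp {AP : Type} (M : Set (KripkeTree AP)) (L L' : MLogic AP) : Prop :=
  ¬ Leq M L L' ∧ ¬ Leq M L' L

end MLogic

/-! ## The concrete logics -/

def MSOdom : SODom := fun T => {S | S ⊆ T}
def MTLdom : SODom := fun T => {S | S ⊆ T ∧ IsTree S}
def MPLdom : SODom := fun T => {S | IsPathOf T S}
def weakDom (D : SODom) : SODom := fun T => {S | S ∈ D T ∧ S.Finite}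
def coweakDom (D : SODom) : SODom := fun T => {S | S ∈ D T ∧ S.Infinite}

def MSO (AP : Type) : MLogic AP := ⟨fun _ => True, MSOdom⟩
def MTL (AP : Type) : MLogic AP := ⟨fun _ => True, MTLdom⟩
def MPL (AP : Type) : MLogic AP := ⟨fun _ => True, MPLdom⟩
def WMSO (AP : Type) : MLogic AP := ⟨fun _ => True, weakDom MSOdom⟩
def WMTL (AP : Type) : MLogic AP := ⟨fun _ => True, weakDom MTLdom⟩
def WMPL (AP : Type) : MLogic AP := ⟨fun _ => True, weakDom MPLdom⟩
def CoWMSO (AP : Type) : MLogic AP := ⟨fun _ => True, coweakDom MSOdom⟩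
def CoWMTL (AP : Type) : MLogic AP := ⟨fun _ => True, coweakDom MTLdom⟩
def CoWMPL (AP : Type) : MLogic AP := ⟨fun _ => True, coweakDom MPLdom⟩
def FOL (AP : Type) : MLogic AP := ⟨MSOL.IsFO, MSOdom⟩

/-! ## Classes of Kripke trees -/

def allKT (AP : Type) : Set (KripkeTree AP) := Set.univ
def finBrKT (AP : Type) : Set (KripkeTree AP) := {K | FinBranching K.T}
/-- Kripke trees whose underlying tree is an infinite chain
(every node has exactly one child). -/
def chainKT (AP : Type) : Set (KripkeTree AP) :=
  {K | ∀ τ ∈ K.T, ∃! τ' : Node, childIn K.T τ τ'}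

/-! ## Part 1: relativization -/

theorem treeRooted_iff (T : Set Node) (r : Node) : IsTreeRooted T r ↔
    r ∈ T ∧ (∀ τ ∈ T, r <+: τ) ∧ ∀ x ∈ T, ∀ y, r <+: y → y <+: x → y ∈ T := by
  unfold IsTreeRooted
  constructor
  · rintro ⟨h1, h2, h3⟩
    refine ⟨h1, h2, ?_⟩
    rintro x hx y ⟨s, rfl⟩ hy
    obtain ⟨t, rfl⟩ := h2 x hx
    exact h3 t s hx ((List.prefix_append_right_inj r).1 hy)
  · rintro ⟨h1, h2, h3⟩
    refine ⟨h1, h2, ?_⟩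
    intro s s' hs hp
    exact h3 _ hs _ (List.prefix_append _ _) ((List.prefix_append_right_inj r).2 hp)

namespace MSOL
variable {AP : Type}

def imp (φ ψ : MSOL AP) : MSOL AP := not (and φ (not ψ))
def or (φ ψ : MSOL AP) : MSOL AP := not (and (not φ) (not ψ))
def all (x : ℕ) (φ : MSOL AP) : MSOL AP := not (exFO x (not φ))

def tr (G : ℕ → MSOL AP) : MSOL AP → MSOL AP
  | atom a x => atom a x
  | le x y => le x y
  | mem x X => mem x X
  | not φ => not (tr G φ)
  | and φ ψ => and (tr G φ) (tr G ψ)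
  | exFO x φ => exFO x (tr G φ)
  | exSO X φ => exSO X (and (G X) (tr G φ))

def qd : MSOL AP → ℕ
  | atom _ _ => 0
  | le _ _ => 0
  | mem _ _ => 0
  | not φ => qd φ
  | and φ ψ => max (qd φ) (qd ψ)
  | exFO _ φ => qd φ + 1
  | exSO _ φ => qd φ + 2

end MSOL

section
variable {AP : Type} (D : SODom) (K : KripkeTree AP) (V1 : ℕ → Node) (V2 : ℕ → Set Node)
open MSOL

theorem sat_imp (φ ψ : MSOL AP) :
    Sat D K V1 V2 (imp φ ψ) ↔ (Sat D K V1 V2 φ → Sat D K V1 V2 ψ) := by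
  simp [imp, Sat]

theorem sat_or (φ ψ : MSOL AP) :
    Sat D K V1 V2 (MSOL.or φ ψ) ↔ (Sat D K V1 V2 φ ∨ Sat D K V1 V2 ψ) := by
  simp [MSOL.or, Sat]; tauto

theorem sat_all (x : ℕ) (φ : MSOL AP) :
    Sat D K V1 V2 (all x φ) ↔ ∀ τ ∈ K.T, Sat D K (Function.update V1 x τ) V2 φ := by
  simp [all, Sat]

end

theorem tr_leq {AP : Type} (M : Set (KripkeTree AP)) (D D' : SODom) (G : ℕ → MSOL AP)
    (hD : ∀ T, D T ⊆ D' T)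
    (hG : ∀ K V1 V2 X, V2 X ∈ D' (KripkeTree.T K) → (Sat D' K V1 V2 (G X) ↔ V2 X ∈ D K.T))
    (h1 : ∀ X, (G X).freeFO = ∅) (h2 : ∀ X, (G X).freeSO = {X}) :
    MLogic.Leq M ⟨fun _ => True, D⟩ ⟨fun _ => True, D'⟩ := by
  have hs : ∀ (K : KripkeTree AP) (φ : MSOL AP) V1 V2,
      Sat D' K V1 V2 (MSOL.tr G φ) ↔ Sat D K V1 V2 φ := by
    intro K φ
    induction φ with
    | atom a x => intros; rfl
    | le x y => intros; rfl
    | mem x X => intros; rfl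
    | not φ ih => intro V1 V2; simp [MSOL.tr, Sat, ih]
    | and φ ψ ih ih' => intro V1 V2; simp [MSOL.tr, Sat, ih, ih']
    | exFO x φ ih => intro V1 V2; simp [MSOL.tr, Sat, ih]
    | exSO X φ ih =>
      intro V1 V2
      simp only [MSOL.tr, Sat, ih]
      constructor
      · rintro ⟨S, hS, hg, hh⟩
        refine ⟨S, ?_, hh⟩
        have := (hG K V1 (Function.update V2 X S) X (by simpa using hS)).1 hg
        simpa using this
      · rintro ⟨S, hS, hh⟩
        refine ⟨S, hD _ hS, ?_, hh⟩
        exact (hG K V1 (Function.update V2 X S) X (by simpa using hD _ hS)).2 (by simpa using hS)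
  have hf1 : ∀ φ : MSOL AP, (MSOL.tr G φ).freeFO = φ.freeFO := by
    intro φ
    induction φ <;> simp_all [MSOL.tr, MSOL.freeFO]
  have hf2 : ∀ φ : MSOL AP, (MSOL.tr G φ).freeSO = φ.freeSO := by
    intro φ
    induction φ <;> simp_all [MSOL.tr, MSOL.freeSO]
  intro φ hφ _
  refine ⟨MSOL.tr G φ, ⟨by rw [hf1]; exact hφ.1, by rw [hf2]; exact hφ.2⟩, trivial, ?_⟩
  intro K _
  simp only [MLogic.KSat, hs]

theorem mpl_leq_mtl (AP : Type) (M : Set (KripkeTree AP)) : MLogic.Leq M (MPL AP) (MTL AP) := by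
  refine tr_leq M MPLdom MTLdom
    (fun X => MSOL.all 0 (MSOL.all 1 (.imp (.mem 0 X) (.imp (.mem 1 X) (.or (.le 0 1) (.le 1 0))))))
    ?_ ?_ ?_ ?_
  · intro T S h
    exact h.1
  · intro K V1 V2 X h
    simp only [sat_all, sat_imp, sat_or, Sat]
    simp
    generalize V2 X = S at *
    obtain ⟨hST, r, hr⟩ := h
    constructor
    · intro hc
      refine ⟨⟨hST, r, hr⟩, ?_⟩
      intro τ hτ n m hn hm
      rcases hc _ (hST hn) _ (hST hm) hn hm with h | h
      · simpa using h.2.2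
      · have h3 : m = n := by simpa using h.2.2
        exact h3.symm
    · rintro ⟨-, hp⟩ x hx y hy hxS hyS
      rw [treeRooted_iff] at hr
      obtain ⟨h1, h2, h3⟩ := hr
      have key : ∀ s t, r ++ s ∈ S → r ++ t ∈ S → s <+: t ∨ t <+: s := by
        intro s
        induction s using List.reverseRecOn with
        | nil => intro t _ _; left; simp
        | append_singleton s a ih =>
          intro t hs ht
          have hs' : r ++ s ∈ S := h3 _ hs _ (List.prefix_append _ _) ⟨[a], by simp⟩
          rcases ih t hs' ht with ⟨u, rfl⟩ | h
          · cases u with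
            | nil => right; simp
            | cons b u =>
              left
              have hb : r ++ s ++ [b] ∈ S := h3 _ ht _ (by simp) ⟨u, by simp⟩
              have := hp _ hs' a b (by simpa using hs) hb
              subst this
              exact ⟨u, by simp⟩
          · right; exact h.trans ⟨[a], rfl⟩
      obtain ⟨s, rfl⟩ := h2 x hxS
      obtain ⟨t, rfl⟩ := h2 y hyS
      simp only [List.prefix_append_right_inj]
      rcases key s t hxS hyS with h | h
      · exact Or.inl ⟨hx, hy, h⟩
      · exact Or.inr ⟨hy, hx, h⟩
  · intro X
    ext; simp [MSOL.all, MSOL.imp, MSOL.or, MSOL.freeFO]; try omega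
  · intro X
    ext; simp [MSOL.all, MSOL.imp, MSOL.or, MSOL.freeSO]

theorem mtl_leq_mso (AP : Type) (M : Set (KripkeTree AP)) : MLogic.Leq M (MTL AP) (MSO AP) := by
  refine tr_leq M MTLdom MSOdom
    (fun X => MSOL.exFO 0 (.and (.mem 0 X) (MSOL.all 1 (.imp (.mem 1 X)
      (.and (.le 0 1) (MSOL.all 2 (.imp (.and (.le 0 2) (.le 2 1)) (.mem 2 X))))))))
    ?_ ?_ ?_ ?_
  · intro T S h
    exact h.1
  · intro K V1 V2 X h
    simp only [sat_all, sat_imp, sat_or, Sat]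
    simp
    generalize V2 X = S at *
    have hST : S ⊆ K.T := h
    have hK := (treeRooted_iff _ _).1 K.rooted
    constructor
    · rintro ⟨r, hr, hrS, hc⟩
      refine ⟨hST, r, ?_⟩
      rw [treeRooted_iff]
      refine ⟨hrS, fun τ hτ => (hc τ (hST hτ) hτ).1.2.2, ?_⟩
      intro x hx y hy hyx
      have hyT : y ∈ K.T := hK.2.2 x (hST hx) y ((hK.2.1 r hr).trans hy) hyx
      exact (hc x (hST hx) hx).2 y hyT hr hyT hy hyT (hST hx) hyx
    · rintro ⟨-, r, hr⟩
      rw [treeRooted_iff] at hr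
      obtain ⟨h1, h2, h3⟩ := hr
      refine ⟨r, hST h1, h1, fun x hx hxS => ⟨⟨hST h1, hx, h2 x hxS⟩, ?_⟩⟩
      intro y hy _ _ h4 _ _ h5
      exact h3 x hxS y h4 h5
  · intro X
    ext; simp [MSOL.all, MSOL.imp, MSOL.or, MSOL.freeFO]; try omega
  · intro X
    ext; simp [MSOL.all, MSOL.imp, MSOL.or, MSOL.freeSO]

theorem sat_congr {AP : Type} (D : SODom) (K : KripkeTree AP) (φ : MSOL AP) :
    ∀ V1 V2 V1' V2', (∀ x ∈ φ.freeFO, V1 x = V1' x) → (∀ x ∈ φ.freeSO, V2 x = V2' x) →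
      (Sat D K V1 V2 φ ↔ Sat D K V1' V2' φ) := by
  induction φ with
  | atom a x => intro V1 V2 V1' V2' h1 h2; simp [MSOL.freeFO] at h1; simp [Sat, h1]
  | le x y => intro V1 V2 V1' V2' h1 h2; simp [MSOL.freeFO] at h1; simp [Sat, h1]
  | mem x X =>
    intro V1 V2 V1' V2' h1 h2
    simp [MSOL.freeFO] at h1; simp [MSOL.freeSO] at h2; simp [Sat, h1, h2]
  | not φ ih =>
    intro V1 V2 V1' V2' h1 h2
    simp only [Sat]; rw [ih V1 V2 V1' V2' h1 h2]
  | and φ ψ ih ih' =>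
    intro V1 V2 V1' V2' h1 h2
    simp only [Sat]
    rw [ih V1 V2 V1' V2' (fun x hx => h1 x (Or.inl hx)) (fun x hx => h2 x (Or.inl hx)),
      ih' V1 V2 V1' V2' (fun x hx => h1 x (Or.inr hx)) (fun x hx => h2 x (Or.inr hx))]
  | exFO x φ ih =>
    intro V1 V2 V1' V2' h1 h2
    simp only [Sat]
    refine exists_congr fun τ => and_congr_right fun _ => ih _ _ _ _ ?_ h2
    intro y hy
    by_cases h : y = x
    · subst h; simp
    · simp [h, h1 y ⟨hy, h⟩]
  | exSO X φ ih =>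
    intro V1 V2 V1' V2' h1 h2
    simp only [Sat]
    refine exists_congr fun τ => and_congr_right fun _ => ih _ _ _ _ h1 ?_
    intro y hy
    by_cases h : y = X
    · subst h; simp
    · simp [h, h2 y ⟨hy, h⟩]

theorem ksat_iff {AP : Type} (L : MLogic AP) (K : KripkeTree AP) (φ : MSOL AP)
    (h : φ.IsSentence) (V1 V2) : L.KSat K φ ↔ Sat L.dom K V1 V2 φ := by
  constructor
  · rintro ⟨W1, W2, hW⟩
    refine (sat_congr _ _ _ _ _ _ _ ?_ ?_).1 hW <;> simp [h.1, h.2]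
  · intro h; exact ⟨_, _, h⟩

/-! ## Part 2: the trees -/

def enc (i : ℕ) (g : List ℕ) : Node := List.replicate i 0 ++ g

def Vld (g : List ℕ) : Prop := ∀ l, g ≠ 0 :: l

theorem enc_zero (g) : enc 0 g = g := by simp [enc]
theorem enc_succ (i g) : enc (i + 1) g = 0 :: enc i g := by simp [enc, List.replicate_succ]

theorem enc_prefix {g h : List ℕ} (hg : Vld g) (hh : Vld h) : ∀ i j,
    (enc i g <+: enc j h ↔ (g = [] ∧ i ≤ j) ∨ (i = j ∧ g <+: h)) := by
  intro i
  induction i with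
  | zero =>
    intro j
    cases j with
    | zero => simp [enc_zero]; rintro rfl; simp
    | succ j =>
      rw [enc_zero, enc_succ]
      cases g with
      | nil => simp
      | cons a l =>
        simp [List.cons_prefix_cons]
        rintro rfl
        exact absurd rfl (hg l)
  | succ i ih =>
    intro j
    cases j with
    | zero =>
      rw [enc_zero, enc_succ]
      simp
      rintro ⟨t, ht⟩
      exact hh _ ht.symm
    | succ j =>
      rw [enc_succ, enc_succ]
      simp [List.cons_prefix_cons, ih]

theorem enc_inj {g h : List ℕ} (hg : Vld g) (hh : Vld h) {i j} (e : enc i g = enc j h) :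
    i = j ∧ g = h := by
  have h1 := (enc_prefix hg hh i j).1 (by rw [e])
  have h2 := (enc_prefix hh hg j i).1 (by rw [e])
  have : i = j := by omega
  subst this
  refine ⟨rfl, ?_⟩
  simpa [enc] using e

theorem prefix_enc {y : Node} {g : List ℕ} : ∀ {i}, y <+: enc i g →
    (∃ j, j < i ∧ y = enc j []) ∨ ∃ g', g' <+: g ∧ y = enc i g' := by
  intro i
  induction i generalizing y with
  | zero => intro h; right; exact ⟨y, by simpa [enc_zero] using h, by simp [enc_zero]⟩
  | succ i ih =>
    intro h
    rw [enc_succ] at h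
    cases y with
    | nil => left; exact ⟨0, by omega, by simp [enc]⟩
    | cons a y =>
      rw [List.cons_prefix_cons] at h
      obtain ⟨rfl, h⟩ := h
      rcases ih h with ⟨j, hj, rfl⟩ | ⟨g', hg, rfl⟩
      · left; exact ⟨j + 1, by omega, by rw [enc_succ]⟩
      · right; exact ⟨g', hg, by rw [enc_succ]⟩

/-- allowed side branches at position `i`. -/
def Adm (b : Bool) (n i : ℕ) (g : List ℕ) : Prop :=
  g = [] ∨ ∃ c j, g = c :: List.replicate j 0 ∧ (c = 1 ∨ (c = 2 ∧ b = false)) ∧ (b = false → i = n)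

theorem Adm.vld {b n i g} (h : Adm b n i g) : Vld g := by
  rintro l rfl
  rcases h with h | ⟨c, j, h, hc, -⟩
  · cases h
  · cases h; omega

theorem Adm.pre {b n i g g'} (h : Adm b n i g) (hp : g' <+: g) : Adm b n i g' := by
  rcases h with rfl | ⟨c, j, rfl, hc, hi⟩
  · left; simpa using hp
  · cases g' with
    | nil => left; rfl
    | cons a l =>
      rw [List.cons_prefix_cons] at hp
      obtain ⟨rfl, hp⟩ := hp
      right
      refine ⟨a, l.length, ?_, hc, hi⟩
      congr 1
      rw [List.eq_replicate_iff]
      refine ⟨rfl, fun x hx => List.eq_of_mem_replicate (hp.subset hx)⟩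

def FT (b : Bool) (n : ℕ) : Set Node := {x | ∃ i g, i ≤ n ∧ Adm b n i g ∧ x = enc i g}

theorem vld_nil : Vld [] := by intro l h; cases h

theorem mem_FT {b n i g} (hi : i ≤ n) (h : Adm b n i g) : enc i g ∈ FT b n := ⟨i, g, hi, h, rfl⟩

theorem FT_pre {b n x y} (hx : x ∈ FT b n) (hy : y <+: x) : y ∈ FT b n := by
  obtain ⟨i, g, hi, hA, rfl⟩ := hx
  rcases prefix_enc hy with ⟨j, hj, rfl⟩ | ⟨g', hg, rfl⟩
  · exact mem_FT (by omega) (Or.inl rfl)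
  · exact mem_FT hi (hA.pre hg)

theorem FT_rooted (b n) : IsTreeRooted (FT b n) [] := by
  rw [treeRooted_iff]
  refine ⟨⟨0, [], by omega, Or.inl rfl, by simp [enc]⟩, by simp, fun x hx y _ h => FT_pre hx h⟩

theorem enc_append (i g h) : enc i (g ++ h) = enc i g ++ h := by simp [enc]

theorem FT_nb (b n) : NonBlocking (FT b n) := by
  rintro τ ⟨i, g, hi, hA, rfl⟩
  rcases hA with rfl | ⟨c, j, rfl, hc, hh⟩
  · by_cases h : i = n
    · refine ⟨1, i, [1], hi, Or.inr ⟨1, 0, rfl, Or.inl rfl, fun _ => h⟩, by simp [enc]⟩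
    · refine ⟨0, i + 1, [], by omega, Or.inl rfl, by simp [enc, List.replicate_succ']⟩
  · refine ⟨0, i, c :: List.replicate (j + 1) 0, hi, Or.inr ⟨c, j + 1, rfl, hc, hh⟩,
      by simp [enc, List.replicate_succ']⟩

theorem FT_le2 {b n x} (hx : x ∈ FT b n) : ∀ k ∈ x, k ≤ 2 := by
  obtain ⟨i, g, hi, hA, rfl⟩ := hx
  intro k hk
  rcases hA with rfl | ⟨c, j, rfl, hc, hh⟩ <;> simp [enc] at hk <;> omega

theorem FT_fb (b n) : FinBranching (FT b n) := by
  intro τ _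
  refine ((Set.finite_Iic 2).image (fun k => τ ++ [k])).subset ?_
  rintro x ⟨hx, k, rfl⟩
  exact ⟨k, FT_le2 hx k (by simp), rfl⟩

def KT (AP : Type) (b : Bool) (n : ℕ) : KripkeTree AP where
  T := FT b n
  root := []
  rooted := FT_rooted b n
  nonblocking := FT_nb b n
  Lab := fun _ => ∅

def Dm (b : Bool) : SODom := if b then MPLdom else MTLdom

def shp (r m : ℕ) (H : Set (List ℕ)) : Set Node :=
  {x | (∃ i, r ≤ i ∧ i < m ∧ x = enc i []) ∨ ∃ g ∈ H, x = enc m g}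

theorem mem_shp {r m H i g} (hg : Vld g) (hH : ∀ h ∈ H, Vld h) :
    enc i g ∈ shp r m H ↔ (r ≤ i ∧ i < m ∧ g = []) ∨ (i = m ∧ g ∈ H) := by
  constructor
  · rintro (⟨j, h1, h2, e⟩ | ⟨h, hh, e⟩)
    · obtain ⟨rfl, rfl⟩ := enc_inj hg vld_nil e
      exact Or.inl ⟨h1, h2, rfl⟩
    · obtain ⟨rfl, rfl⟩ := enc_inj hg (hH _ hh) e
      exact Or.inr ⟨rfl, hh⟩
  · rintro (⟨h1, h2, rfl⟩ | ⟨rfl, h⟩)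
    · exact Or.inl ⟨i, h1, h2, rfl⟩
    · exact Or.inr ⟨g, h, rfl⟩

structure HOK (b : Bool) (n r m : ℕ) (H : Set (List ℕ)) : Prop where
  rm : r ≤ m
  mn : m ≤ n
  adm : ∀ g ∈ H, Adm b n m g
  tree : IsTree H
  nil : r < m → [] ∈ H
  chain : b = true → ∀ τ ∈ H, ∀ k l : ℕ, τ ++ [k] ∈ H → τ ++ [l] ∈ H → k = l

theorem enc_pre_same {i g h} : enc i g <+: enc i h ↔ g <+: h := by
  simp [enc, List.prefix_append_right_inj]

theorem shp_tree {b n r m H} (h : HOK b n r m H) : IsTree (shp r m H) := by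
  have hv : ∀ g ∈ H, Vld g := fun g hg => (h.adm g hg).vld
  obtain ⟨ρ, hρ⟩ := h.tree
  rw [treeRooted_iff] at hρ
  obtain ⟨t1, t2, t3⟩ := hρ
  rcases h.rm.lt_or_eq with hlt | rfl
  · have hn := h.nil hlt
    have : ρ = [] := by simpa using t2 _ hn
    subst this
    refine ⟨enc r [], ?_⟩
    rw [treeRooted_iff]
    refine ⟨Or.inl ⟨r, le_rfl, hlt, rfl⟩, ?_, ?_⟩
    · rintro τ (⟨i, h1, h2, rfl⟩ | ⟨g, hg, rfl⟩)
      · rw [enc_prefix vld_nil vld_nil]; simp [h1]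
      · rw [enc_prefix vld_nil (hv g hg)]; simp [hlt.le]
    · rintro x hx y hry hyx
      have aux : ∀ j, j ≤ m → y = enc j [] → y ∈ shp r m H := by
        rintro j hj rfl
        rw [enc_prefix vld_nil vld_nil] at hry
        rcases hj.lt_or_eq with hj | rfl
        · exact Or.inl ⟨j, by omega, hj, rfl⟩
        · exact Or.inr ⟨[], hn, rfl⟩
      rcases hx with (⟨i, h1, h2, rfl⟩ | ⟨g, hg, rfl⟩)
      · rcases prefix_enc hyx with ⟨j, hj, e⟩ | ⟨g', hg, e⟩
        · exact aux j (by omega) e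
        · have : g' = [] := by simpa using hg
          subst this
          exact aux i (by omega) e
      · rcases prefix_enc hyx with ⟨j, hj, e⟩ | ⟨g', hg', e⟩
        · exact aux j (by omega) e
        · exact Or.inr ⟨g', t3 g hg g' (by simp) hg', e⟩
  · refine ⟨enc r ρ, ?_⟩
    rw [treeRooted_iff]
    refine ⟨Or.inr ⟨ρ, t1, rfl⟩, ?_, ?_⟩
    · rintro τ (⟨i, h1, h2, rfl⟩ | ⟨g, hg, rfl⟩)
      · omega
      · exact enc_pre_same.2 (t2 g hg)
    · rintro x (⟨i, h1, h2, rfl⟩ | ⟨g, hg, rfl⟩) y hry hyx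
      · omega
      rcases prefix_enc hyx with ⟨j, hj, rfl⟩ | ⟨g', hg', rfl⟩
      · have := hry.length_le
        simp [enc] at this; omega
      · exact Or.inr ⟨g', t3 g hg g' (enc_pre_same.1 hry) hg', rfl⟩

theorem shp_sub {b n r m H} (h : HOK b n r m H) : shp r m H ⊆ FT b n := by
  have hmn := h.mn
  rintro x (⟨i, h1, h2, rfl⟩ | ⟨g, hg, rfl⟩)
  · exact mem_FT (by omega) (Or.inl rfl)
  · exact mem_FT h.mn (h.adm g hg)

theorem shp_dom {b n r m H} (h : HOK b n r m H) : shp r m H ∈ Dm b (FT b n) := by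
  have hv : ∀ g ∈ H, Vld g := fun g hg => (h.adm g hg).vld
  cases b with
  | false => exact ⟨shp_sub h, shp_tree h⟩
  | true =>
    refine ⟨⟨shp_sub h, shp_tree h⟩, ?_⟩
    rintro τ (⟨i, h1, h2, rfl⟩ | ⟨g, hg, rfl⟩) k l hk hl
    · have aux : ∀ k, enc i [] ++ [k] ∈ shp r m H → k = 0 := by
        rintro k (⟨j, h3, h4, e⟩ | ⟨g, hg, e⟩)
        · have : k ∈ enc j [] := by rw [← e]; simp
          simpa [enc] using (by simpa [enc] using this : _ ∧ k = 0).2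
        · have e2 : enc i [k] = enc m g := by rw [← e]; simp [enc]
          by_contra hk
          have := (enc_inj (by rintro l h; cases h; exact hk rfl) (hv g hg) e2).1
          omega
      rw [aux k hk, aux l hl]
    · have aux : ∀ k, enc m g ++ [k] ∈ shp r m H → g ++ [k] ∈ H := by
        rintro k (⟨j, h3, h4, e⟩ | ⟨g', hg', e⟩)
        · have := congrArg List.length e
          simp [enc] at this; omega
        · rw [← enc_append] at e
          have : g ++ [k] = g' := by simpa [enc] using e
          rwa [this]
      exact h.chain rfl g hg k l (aux k hk) (aux l hl)

theorem dom_shp {b n S} (hS : S ∈ Dm b (FT b n)) : ∃ r m H, HOK b n r m H ∧ S = shp r m H := by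
  classical
  have hST : S ⊆ FT b n ∧ IsTree S := by
    cases b with
    | false => exact hS
    | true => exact hS.1
  have hch : b = true → ∀ τ ∈ S, ∀ n m : ℕ, τ ++ [n] ∈ S → τ ++ [m] ∈ S → n = m := by
    rintro rfl; exact hS.2
  obtain ⟨hsub, ρ, hρ⟩ := hST
  rw [treeRooted_iff] at hρ
  obtain ⟨t1, t2, t3⟩ := hρ
  obtain ⟨i, g, hi, hA, rfl⟩ := hsub t1
  -- generic data for a given `m`
  have hadm : ∀ m ≤ n, ∀ h, Vld h → enc m h ∈ S → Adm b n m h := by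
    intro m hm h hv hh
    obtain ⟨j, h', hj, hA', e⟩ := hsub hh
    obtain ⟨rfl, rfl⟩ := enc_inj hv hA'.vld e
    exact hA'
  have hch' : ∀ m, b = true → ∀ τ ∈ {h | Vld h ∧ enc m h ∈ S}, ∀ k l : ℕ,
      τ ++ [k] ∈ {h | Vld h ∧ enc m h ∈ S} → τ ++ [l] ∈ {h | Vld h ∧ enc m h ∈ S} → k = l := by
    intro m hb τ hτ k l hk hl
    exact hch hb _ hτ.2 k l (by rw [← enc_append]; exact hk.2) (by rw [← enc_append]; exact hl.2)
  by_cases hg : g = []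
  · subst hg
    let Q : ℕ → Prop := fun m => enc m [] ∈ S
    let m := Nat.findGreatest Q n
    have hm : enc m [] ∈ S := Nat.findGreatest_spec (P := Q) hi t1
    have hmn : m ≤ n := Nat.findGreatest_le n
    have him : i ≤ m := Nat.le_findGreatest hi t1
    have hmax : ∀ j ≤ n, enc j [] ∈ S → j ≤ m := fun j hj h => Nat.le_findGreatest hj h
    refine ⟨i, m, {h | Vld h ∧ enc m h ∈ S},
      ⟨him, hmn, fun h hh => hadm m hmn h hh.1 hh.2, ⟨[], ?_⟩, fun _ => ⟨vld_nil, hm⟩, hch' m⟩, ?_⟩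
    · rw [treeRooted_iff]
      refine ⟨⟨vld_nil, hm⟩, by simp, ?_⟩
      rintro x ⟨hx1, hx2⟩ y - hy
      refine ⟨((hadm m hmn x hx1 hx2).pre hy).vld, t3 _ hx2 _ ?_ (enc_pre_same.2 hy)⟩
      exact (t2 _ hm).trans (enc_pre_same.2 (by simp))
    · ext x
      constructor
      · intro hx
        obtain ⟨j, h, hj, hAj, rfl⟩ := hsub hx
        have hij0 := (enc_prefix vld_nil hAj.vld i j).1 (t2 _ hx)
        have hij : i ≤ j := by omega
        have hjS : enc j [] ∈ S := t3 _ hx _ ((enc_prefix vld_nil vld_nil i j).2 (by simp [hij]))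
          (enc_pre_same.2 (by simp))
        have hjm := hmax j hj hjS
        rcases hjm.lt_or_eq with hlt | rfl
        · rcases hAj with rfl | ⟨c, k, rfl, hc, hb⟩
          · exact Or.inl ⟨j, hij, hlt, rfl⟩
          · exfalso
            have hbt : b = true := by
              cases b with
              | true => rfl
              | false => have := hb rfl; omega
            have e1 : enc j [] ++ [0] ∈ S := by
              have : enc j [] ++ [0] = enc (j + 1) [] := by simp [enc, List.replicate_succ']
              rw [this]
              exact t3 _ hm _ ((enc_prefix vld_nil vld_nil _ _).2 (by simp; omega))
                ((enc_prefix vld_nil vld_nil _ _).2 (by simp; omega))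
            have e2 : enc j [] ++ [c] ∈ S := by
              refine t3 _ hx _ ((t2 _ hjS).trans (by simp)) ?_
              exact ⟨List.replicate k 0, by simp [enc]⟩
            have := hch hbt _ hjS 0 c e1 e2
            omega
        · exact Or.inr ⟨h, ⟨hAj.vld, hx⟩, rfl⟩
      · rintro (⟨j, h1, h2, rfl⟩ | ⟨g, hg, rfl⟩)
        · exact t3 _ hm _ ((enc_prefix vld_nil vld_nil _ _).2 (by simp; omega))
                ((enc_prefix vld_nil vld_nil _ _).2 (by simp; omega))
        · exact hg.2
  · refine ⟨i, i, {h | Vld h ∧ enc i h ∈ S},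
      ⟨le_rfl, hi, fun h hh => hadm i hi h hh.1 hh.2, ⟨g, ?_⟩, fun h => by omega, hch' i⟩, ?_⟩
    · rw [treeRooted_iff]
      refine ⟨⟨hA.vld, t1⟩, fun τ hτ => enc_pre_same.1 (t2 _ hτ.2), ?_⟩
      rintro x ⟨hx1, hx2⟩ y hgy hy
      exact ⟨((hadm i hi x hx1 hx2).pre hy).vld, t3 _ hx2 _ (enc_pre_same.2 hgy) (enc_pre_same.2 hy)⟩
    · ext x
      constructor
      · intro hx
        obtain ⟨j, h, hj, hAj, rfl⟩ := hsub hx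
        have := (enc_prefix hA.vld hAj.vld i j).1 (t2 _ hx)
        simp [hg] at this
        obtain ⟨rfl, -⟩ := this
        exact Or.inr ⟨h, ⟨hAj.vld, hx⟩, rfl⟩
      · rintro (⟨j, h1, h2, rfl⟩ | ⟨g, hg, rfl⟩)
        · omega
        · exact hg.2

/-! ## Part 3: the game -/

def Near (k i j i' j' : ℕ) : Prop :=
  i + j' = i' + j ∨ (i + 2 ^ k ≤ j ∧ i' + 2 ^ k ≤ j') ∨ (j + 2 ^ k ≤ i ∧ j' + 2 ^ k ≤ i')

structure Good (k n n' : ℕ) (P : ℕ → ℕ → Prop) : Prop where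
  z : P 0 0
  e : P n n'
  bd : ∀ i i', P i i' → i ≤ n ∧ i' ≤ n'
  nr : ∀ i i' j j', P i i' → P j j' → Near k i j i' j'

theorem Good.symm {k n n' P} (h : Good k n n' P) : Good k n' n (fun i j => P j i) := by
  refine ⟨h.z, h.e, fun i i' hh => (h.bd _ _ hh).symm, fun i i' j j' h1 h2 => ?_⟩
  have := h.nr _ _ _ _ h1 h2
  unfold Near at *
  omega

theorem Good.le_iff {k n n' P} (h : Good k n n' P) {i i' j j'} (h1 : P i i') (h2 : P j j') :
    i ≤ j ↔ i' ≤ j' := by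
  have := h.nr _ _ _ _ h1 h2
  have : 0 < 2 ^ k := by positivity
  unfold Near at *
  omega

theorem Good.extend {k n n' P} (h : Good (k + 1) n n' P) {p : ℕ} (hp : p ≤ n) :
    ∃ p' P', (∀ i i', P i i' → P' i i') ∧ P' p p' ∧ Good k n n' P' := by
  classical
  -- nearest neighbours
  obtain ⟨l, l', hl, hlp, hlmax⟩ : ∃ l l', P l l' ∧ l ≤ p ∧ ∀ j j', P j j' → j ≤ p → j ≤ l := by
    let Q : ℕ → Prop := fun j => ∃ j', P j j'
    obtain ⟨l', hl'⟩ : Q (Nat.findGreatest Q p) :=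
      Nat.findGreatest_spec (P := Q) (Nat.zero_le p) ⟨0, h.z⟩
    exact ⟨_, l', hl', Nat.findGreatest_le p, fun j j' hj hjp => Nat.le_findGreatest hjp ⟨j', hj⟩⟩
  obtain ⟨u, u', hu, hup, humin⟩ : ∃ u u', P u u' ∧ p ≤ u ∧ ∀ j j', P j j' → p ≤ j → u ≤ j := by
    have hex : ∃ u, p ≤ u ∧ ∃ u', P u u' := ⟨n, hp, n', h.e⟩
    obtain ⟨h1, u', h2⟩ := Nat.find_spec hex
    exact ⟨_, u', h2, h1, fun j j' hj hjp => Nat.find_min' hex ⟨hjp, j', hj⟩⟩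
  have hlu := h.nr _ _ _ _ hl hu
  have hpow : 2 ^ (k + 1) = 2 * 2 ^ k := by ring
  have hpos : 0 < 2 ^ k := by positivity
  have hbl := h.bd _ _ hl
  have hbu := h.bd _ _ hu
  obtain ⟨p', hp'⟩ : ∃ p', Near k l p l' p' ∧ Near k p u p' u' ∧ l' ≤ p' ∧ p' ≤ u' := by
    unfold Near at *
    rw [hpow] at hlu
    by_cases c1 : p < l + 2 ^ k
    · exact ⟨l' + (p - l), by omega⟩
    · by_cases c2 : u < p + 2 ^ k
      · exact ⟨u' - (u - p), by omega⟩
      · exact ⟨l' + 2 ^ k, by omega⟩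
  obtain ⟨n1, n2, b1, b2⟩ := hp'
  have key : ∀ j j', P j j' → Near k j p j' p' := by
    intro j j' hj
    have a1 := h.nr _ _ _ _ hj hl
    have a2 := h.nr _ _ _ _ hj hu
    have a3 := hlmax j j' hj
    have a4 := humin j j' hj
    unfold Near at *
    rw [hpow] at *
    omega
  refine ⟨p', fun i i' => P i i' ∨ (i = p ∧ i' = p'), fun i i' h => Or.inl h, Or.inr ⟨rfl, rfl⟩,
    Or.inl h.z, Or.inl h.e, ?_, ?_⟩
  · rintro i i' (hi | ⟨rfl, rfl⟩)
    · exact h.bd _ _ hi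
    · omega
  · rintro i i' j j' (hi | ⟨rfl, rfl⟩) (hj | ⟨rfl, rfl⟩)
    · have := h.nr _ _ _ _ hi hj
      unfold Near at *
      rw [hpow] at *
      omega
    · exact key _ _ hi
    · have := key _ _ hj
      unfold Near at *
      omega
    · left; omega

theorem Good.mono {k n n' P} (h : Good (k + 1) n n' P) : Good k n n' P := by
  refine ⟨h.z, h.e, h.bd, fun i i' j j' h1 h2 => ?_⟩
  have := h.nr _ _ _ _ h1 h2
  have hpow : 2 ^ (k + 1) = 2 * 2 ^ k := by ring
  unfold Near at *
  omega

theorem Good.mono_le {n n' P} {k l : ℕ} (hkl : k ≤ l) (h : Good l n n' P) : Good k n n' P := by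
  induction l, hkl using Nat.le_induction with
  | base => exact h
  | succ l _ ih => exact ih h.mono

theorem Good.adm {k n n' P} (h : Good k n n' P) {b i i' g} (hi : P i i') (hA : Adm b n i g) :
    Adm b n' i' g := by
  rcases hA with rfl | ⟨c, j, rfl, hc, hh⟩
  · exact Or.inl rfl
  · refine Or.inr ⟨c, j, rfl, hc, fun hb => ?_⟩
    have h1 := hh hb
    have h2 := h.le_iff h.e hi
    have := h.bd _ _ hi
    omega

theorem Good.hok {k n n' P} (h : Good k n n' P) {b r r' m m' H} (hr : P r r') (hm : P m m')
    (hH : HOK b n r m H) : HOK b n' r' m' H := by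
  refine ⟨(h.le_iff hr hm).1 hH.rm, (h.bd _ _ hm).2, fun g hg => h.adm hm (hH.adm g hg), hH.tree,
    fun hlt => hH.nil ?_, hH.chain⟩
  have := h.le_iff hm hr
  omega

def PtR (b : Bool) (n n' : ℕ) (P : ℕ → ℕ → Prop) (x x' : Node) : Prop :=
  ∃ i i' g, P i i' ∧ Adm b n i g ∧ Adm b n' i' g ∧ x = enc i g ∧ x' = enc i' g

def SetR (P : ℕ → ℕ → Prop) (S S' : Set Node) : Prop :=
  ∃ r r' m m' H, P r r' ∧ P m m' ∧ (∀ g ∈ H, Vld g) ∧ S = shp r m H ∧ S' = shp r' m' H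

structure Cfg (b : Bool) (k n n' : ℕ) (P : ℕ → ℕ → Prop) (V1 : ℕ → Node) (V2 : ℕ → Set Node)
    (V1' : ℕ → Node) (V2' : ℕ → Set Node) : Prop where
  good : Good k n n' P
  pt : ∀ x, PtR b n n' P (V1 x) (V1' x)
  st : ∀ X, SetR P (V2 X) (V2' X)

theorem Cfg.symm {b k n n' P V1 V2 V1' V2'} (h : Cfg b k n n' P V1 V2 V1' V2') :
    Cfg b k n' n (fun i j => P j i) V1' V2' V1 V2 := by
  refine ⟨h.good.symm, fun x => ?_, fun X => ?_⟩
  · obtain ⟨i, i', g, h1, h2, h3, h4, h5⟩ := h.pt x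
    exact ⟨i', i, g, h1, h3, h2, h5, h4⟩
  · obtain ⟨r, r', m, m', H, h1, h2, h3, h4, h5⟩ := h.st X
    exact ⟨r', r, m', m, H, h1, h2, h3, h5, h4⟩

theorem PtR.mono {b n n' P P' x x'} (hP : ∀ i i', P i i' → P' i i') (h : PtR b n n' P x x') :
    PtR b n n' P' x x' := by
  obtain ⟨i, i', g, h1, h2⟩ := h
  exact ⟨i, i', g, hP _ _ h1, h2⟩

theorem SetR.mono {P P' S S'} (hP : ∀ i i', P i i' → P' i i') (h : SetR P S S') :
    SetR P' S S' := by
  obtain ⟨r, r', m, m', H, h1, h2, h3⟩ := h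
  exact ⟨r, r', m, m', H, hP _ _ h1, hP _ _ h2, h3⟩

theorem Cfg.mono_le {b n n' P V1 V2 V1' V2'} {k l : ℕ} (hkl : k ≤ l)
    (h : Cfg b l n n' P V1 V2 V1' V2') : Cfg b k n n' P V1 V2 V1' V2' :=
  ⟨h.good.mono_le hkl, h.pt, h.st⟩

theorem Cfg.forthFO {b k n n' P V1 V2 V1' V2'} (h : Cfg b (k + 1) n n' P V1 V2 V1' V2') (x : ℕ)
    {τ} (hτ : τ ∈ FT b n) : ∃ τ' ∈ FT b n', ∃ P',
      Cfg b k n n' P' (Function.update V1 x τ) V2 (Function.update V1' x τ') V2' := by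
  obtain ⟨i, g, hi, hA, rfl⟩ := hτ
  obtain ⟨i', P', hP, hi', hG⟩ := h.good.extend hi
  refine ⟨enc i' g, mem_FT (hG.bd _ _ hi').2 (hG.adm hi' hA), P', hG, ?_, fun X => (h.st X).mono hP⟩
  intro y
  by_cases hy : y = x
  · subst hy
    simp only [Function.update_self]
    exact ⟨i, i', g, hi', hA, hG.adm hi' hA, rfl, rfl⟩
  · simp only [Function.update_of_ne hy]
    exact (h.pt y).mono hP

theorem Cfg.forthSO {b k n n' P V1 V2 V1' V2'} (h : Cfg b (k + 2) n n' P V1 V2 V1' V2') (X : ℕ)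
    {S} (hS : S ∈ Dm b (FT b n)) : ∃ S' ∈ Dm b (FT b n'), ∃ P',
      Cfg b k n n' P' V1 (Function.update V2 X S) V1' (Function.update V2' X S') := by
  obtain ⟨r, m, H, hH, rfl⟩ := dom_shp hS
  obtain ⟨r', P', hP, hr', hG⟩ := h.good.extend (hH.rm.trans hH.mn)
  obtain ⟨m', P'', hP', hm', hG'⟩ := hG.extend hH.mn
  have hr'' := hP' _ _ hr'
  refine ⟨shp r' m' H, shp_dom (hG'.hok hr'' hm' hH), P'', hG',
    fun x => ((h.pt x).mono hP).mono hP', ?_⟩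
  intro Y
  by_cases hY : Y = X
  · subst hY
    simp only [Function.update_self]
    exact ⟨r, r', m, m', H, hr'', hm', fun g hg => (hH.adm g hg).vld, rfl, rfl⟩
  · simp only [Function.update_of_ne hY]
    exact ((h.st Y).mono hP).mono hP'

theorem Cfg.sat {AP : Type} {b : Bool} (φ : MSOL AP) : ∀ {k n n' P V1 V2 V1' V2'}, φ.qd ≤ k →
    Cfg b k n n' P V1 V2 V1' V2' →
    (Sat (Dm b) (KT AP b n) V1 V2 φ ↔ Sat (Dm b) (KT AP b n') V1' V2' φ) := by
  induction φ with
  | atom a x => intros; simp [Sat, KT]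
  | le x y =>
    intro k n n' P V1 V2 V1' V2' _ h
    obtain ⟨i, i', g, hi, h2, h3, h4, h5⟩ := h.pt x
    obtain ⟨j, j', f, hj, f2, f3, f4, f5⟩ := h.pt y
    have m1 := h.good.bd _ _ hi
    have m2 := h.good.bd _ _ hj
    have l1 := h.good.le_iff hi hj
    have l2 := h.good.le_iff hj hi
    have l3 : i = j ↔ i' = j' := by omega
    simp only [Sat, h4, h5, f4, f5, enc_prefix h2.vld f2.vld, l1, l3]
    simp [KT, mem_FT m1.1 h2, mem_FT m1.2 h3, mem_FT m2.1 f2, mem_FT m2.2 f3]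
  | mem x X =>
    intro k n n' P V1 V2 V1' V2' _ h
    obtain ⟨i, i', g, hi, h2, h3, h4, h5⟩ := h.pt x
    obtain ⟨r, r', m, m', H, hr, hm, hv, f1, f2⟩ := h.st X
    have l1 := h.good.le_iff hr hi
    have l2 := h.good.le_iff hm hi
    have l3 := h.good.le_iff hi hm
    have l4 : i = m ↔ i' = m' := by omega
    have l5 : i < m ↔ i' < m' := by omega
    simp only [Sat, h4, h5, f1, f2, mem_shp h2.vld hv, l1, l4, l5]
  | not φ ih => intro k n n' P V1 V2 V1' V2' hk h; simp only [Sat]; rw [ih hk h]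
  | and φ ψ ih ih' =>
    intro k n n' P V1 V2 V1' V2' hk h
    simp only [MSOL.qd] at hk
    simp only [Sat]; rw [ih (by omega) h, ih' (by omega) h]
  | exFO x φ ih =>
    intro k n n' P V1 V2 V1' V2' hk h
    simp only [MSOL.qd] at hk
    replace h := h.mono_le hk
    simp only [Sat]
    constructor
    · rintro ⟨τ, hτ, hs⟩
      obtain ⟨τ', hτ', P', hc⟩ := h.forthFO x hτ
      exact ⟨τ', hτ', (ih le_rfl hc).1 hs⟩
    · rintro ⟨τ, hτ, hs⟩
      obtain ⟨τ', hτ', P', hc⟩ := h.symm.forthFO x hτ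
      exact ⟨τ', hτ', (ih le_rfl hc).1 hs⟩
  | exSO X φ ih =>
    intro k n n' P V1 V2 V1' V2' hk h
    simp only [MSOL.qd] at hk
    replace h := h.mono_le hk
    simp only [Sat]
    constructor
    · rintro ⟨τ, hτ, hs⟩
      obtain ⟨τ', hτ', P', hc⟩ := h.forthSO X hτ
      exact ⟨τ', hτ', (ih le_rfl hc).1 hs⟩
    · rintro ⟨τ, hτ, hs⟩
      obtain ⟨τ', hτ', P', hc⟩ := h.symm.forthSO X hτ
      exact ⟨τ', hτ', (ih le_rfl hc).1 hs⟩

theorem ksat_game {AP : Type} (b : Bool) (φ : MSOL AP) (hφ : φ.IsSentence) {n n' : ℕ}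
    (hn : 2 ^ φ.qd ≤ n) (hn' : 2 ^ φ.qd ≤ n') :
    (MLogic.KSat ⟨fun _ => True, Dm b⟩ (KT AP b n) φ ↔
      MLogic.KSat ⟨fun _ => True, Dm b⟩ (KT AP b n') φ) := by
  rw [ksat_iff _ _ _ hφ (fun _ => enc 0 []) (fun _ => shp 0 0 ∅),
    ksat_iff _ _ _ hφ (fun _ => enc 0 []) (fun _ => shp 0 0 ∅)]
  refine Cfg.sat (P := fun i i' => (i = 0 ∧ i' = 0) ∨ (i = n ∧ i' = n')) φ le_rfl ⟨⟨?_, ?_, ?_, ?_⟩, ?_, ?_⟩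
  · simp
  · simp
  · intro i i' h; omega
  · intro i i' j j' h1 h2; unfold Near; omega
  · intro x; exact ⟨0, 0, [], by simp, Or.inl rfl, Or.inl rfl, rfl, rfl⟩
  · intro X; exact ⟨0, 0, 0, 0, ∅, by simp, by simp, by simp, rfl, rfl⟩

/-! ## Part 4: the parity sentence -/

namespace MSOL
variable {AP : Type}
def chd (x y z : ℕ) : MSOL AP :=
  and (le x y) (and (not (le y x)) (all z (imp (and (le x z) (le z y)) (or (le z x) (le y z)))))
def brn (x y z : ℕ) : MSOL AP :=
  exFO y (exFO z (and (and (le x y) (le x z)) (and (not (le y z)) (not (le z y)))))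
def ful (x y z : ℕ) : MSOL AP := all y (imp (chd x y z) (mem y 0))

def par : MSOL AP := exSO 0 (and
  (all 0 (imp (all 1 (le 0 1)) (ful 0 2 3)))
  (and
    (all 0 (all 1 (imp (and (and (brn 0 2 3) (brn 1 2 3)) (chd 0 1 2))
      (and (imp (ful 0 2 3) (not (ful 1 2 3))) (imp (not (ful 0 2 3)) (ful 1 2 3))))))
    (all 0 (imp (and (brn 0 2 3) (all 1 (imp (brn 1 2 3) (le 1 0)))) (ful 0 2 3)))))

theorem par_sentence : (par : MSOL AP).IsSentence := by
  constructor
  · ext t; simp [par, ful, chd, brn, all, imp, or, freeFO]; try omega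
  · ext t; simp [par, ful, chd, brn, all, imp, or, freeSO]; try omega
end MSOL

def Brn (T : Set Node) (x : Node) : Prop := ∃ y ∈ T, ∃ z ∈ T, x <+: y ∧ x <+: z ∧ ¬ y <+: z ∧ ¬ z <+: y
def Ful (T S : Set Node) (x : Node) : Prop := ∀ k, x ++ [k] ∈ T → x ++ [k] ∈ S

section
variable {AP : Type} (D : SODom) (K : KripkeTree AP) (V1 : ℕ → Node) (V2 : ℕ → Set Node)

theorem sat_chd (hr : K.root = []) (x y z : ℕ) (hx : V1 x ∈ K.T) (hy : V1 y ∈ K.T)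
    (h1 : z ≠ x) (h2 : z ≠ y) :
    Sat D K V1 V2 (MSOL.chd x y z) ↔ ∃ k, V1 y = V1 x ++ [k] := by
  have hK := (treeRooted_iff _ _).1 K.rooted
  rw [hr] at hK
  simp only [MSOL.chd, sat_all, sat_imp, sat_or, Sat, Function.update_self,
    Function.update_of_ne h1.symm, Function.update_of_ne h2.symm, hx, hy, true_and]
  generalize V1 x = a at *
  generalize V1 y = c at *
  constructor
  · rintro ⟨⟨s, rfl⟩, h4, h5⟩
    cases s with
    | nil => simp at h4
    | cons k s =>
      have hm : a ++ [k] ∈ K.T := hK.2.2 _ hy _ (by simp) ⟨s, by simp⟩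
      have h6 := h5 _ hm (by simp [hm])
      refine ⟨k, ?_⟩
      rcases h6 with h6 | h6
      · have := h6.2.length_le
        simp at this
      · have := h6.2.length_le
        simp at this
        simp [this]
  · rintro ⟨k, rfl⟩
    refine ⟨by simp, fun h => by simpa using h.length_le, ?_⟩
    rintro τ hτ ⟨⟨-, s, rfl⟩, -, h⟩
    rw [List.prefix_append_right_inj] at h
    cases s with
    | nil => left; simp [hx]
    | cons d s =>
      right
      rw [List.cons_prefix_cons] at h
      obtain ⟨rfl, h⟩ := h
      have : s = [] := by simpa using h
      subst this
      simp [hτ]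

theorem sat_brn (x y z : ℕ) (hx : V1 x ∈ K.T) (h1 : z ≠ x) (h2 : y ≠ x) (h3 : y ≠ z) :
    Sat D K V1 V2 (MSOL.brn x y z) ↔ Brn K.T (V1 x) := by
  simp only [MSOL.brn, Sat, Function.update_self, Function.update_of_ne h1.symm,
    Function.update_of_ne h2.symm, Function.update_of_ne h3, hx, true_and, Brn]
  refine exists_congr fun a => and_congr_right fun ha => exists_congr fun c =>
    and_congr_right fun hc => ?_
  simp only [ha, hc]; tauto

theorem sat_ful (hr : K.root = []) (x y z : ℕ) (hx : V1 x ∈ K.T) (h1 : z ≠ x) (h2 : y ≠ x)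
    (h3 : z ≠ y) :
    Sat D K V1 V2 (MSOL.ful x y z) ↔ Ful K.T (V2 0) (V1 x) := by
  simp only [MSOL.ful, sat_all, sat_imp]
  constructor
  · intro h k hk
    have := h _ hk
    rw [sat_chd D K _ _ hr x y z (by simpa [Function.update_of_ne h2.symm] using hx)
      (by simpa using hk) h1 h3] at this
    simpa [Sat, Function.update_of_ne h2.symm] using this
  · intro h τ hτ hc
    rw [sat_chd D K _ _ hr x y z (by simpa [Function.update_of_ne h2.symm] using hx)
      (by simpa using hτ) h1 h3] at hc
    simp only [Function.update_self, Function.update_of_ne h2.symm] at hc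
    obtain ⟨k, rfl⟩ := hc
    simpa [Sat] using h k hτ

theorem sat_par (hr : K.root = []) : Sat D K V1 V2 MSOL.par ↔ ∃ S ∈ D K.T,
    (∀ x ∈ K.T, (∀ y ∈ K.T, x <+: y) → Ful K.T S x) ∧
    (∀ x ∈ K.T, ∀ k, x ++ [k] ∈ K.T → Brn K.T x → Brn K.T (x ++ [k]) →
      (Ful K.T S x ↔ ¬ Ful K.T S (x ++ [k]))) ∧
    (∀ x ∈ K.T, Brn K.T x → (∀ y ∈ K.T, Brn K.T y → y <+: x) → Ful K.T S x) := by
  simp only [MSOL.par, Sat, sat_all, sat_imp]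
  refine exists_congr fun S => and_congr_right fun hS => ?_
  refine and_congr ?_ (and_congr ?_ ?_)
  · refine forall₂_congr fun x hx => ?_
    rw [sat_ful D K _ _ hr 0 2 3 (by simpa using hx) (by simp) (by simp) (by simp)]
    simp +contextual [hx]
  · refine forall₂_congr fun x hx => ?_
    have main : ∀ y ∈ K.T, ((((Sat D K (Function.update (Function.update V1 0 x) 1 y)
        (Function.update V2 0 S) (MSOL.brn 0 2 3) ∧
        Sat D K (Function.update (Function.update V1 0 x) 1 y)
        (Function.update V2 0 S) (MSOL.brn 1 2 3)) ∧
        Sat D K (Function.update (Function.update V1 0 x) 1 y)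
        (Function.update V2 0 S) (MSOL.chd 0 1 2)) ↔
        ((Brn K.T x ∧ Brn K.T y) ∧ ∃ k, y = x ++ [k])) ∧
        (Sat D K (Function.update (Function.update V1 0 x) 1 y)
        (Function.update V2 0 S) (MSOL.ful 0 2 3) ↔ Ful K.T S x) ∧
        (Sat D K (Function.update (Function.update V1 0 x) 1 y)
        (Function.update V2 0 S) (MSOL.ful 1 2 3) ↔ Ful K.T S y)) := by
      intro y hy
      rw [sat_brn D K _ _ 0 2 3 (by simpa using hx) (by simp) (by simp) (by simp),
        sat_brn D K _ _ 1 2 3 (by simpa using hy) (by simp) (by simp) (by simp),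
        sat_chd D K _ _ hr 0 1 2 (by simpa using hx) (by simpa using hy) (by simp) (by simp),
        sat_ful D K _ _ hr 0 2 3 (by simpa using hx) (by simp) (by simp) (by simp),
        sat_ful D K _ _ hr 1 2 3 (by simpa using hy) (by simp) (by simp) (by simp)]
      simp
    constructor
    · intro h k hk h1 h2
      obtain ⟨m1, m2, m3⟩ := main _ hk
      have := h _ hk (m1.2 ⟨⟨h1, h2⟩, k, rfl⟩)
      rw [m2, m3] at this
      tauto
    · intro h y hy
      obtain ⟨m1, m2, m3⟩ := main _ hy
      rw [m1, m2, m3]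
      rintro ⟨⟨h1, h2⟩, k, rfl⟩
      have := h k hy h1 h2
      tauto
  · refine forall₂_congr fun x hx => ?_
    rw [sat_ful D K _ _ hr 0 2 3 (by simpa using hx) (by simp) (by simp) (by simp),
      sat_brn D K _ _ 0 2 3 (by simpa using hx) (by simp) (by simp) (by simp), and_imp]
    simp only [Function.update_self]
    refine imp_congr_right fun _ => imp_congr_left ?_
    refine forall₂_congr fun y hy => ?_
    rw [sat_brn D K _ _ 1 2 3 (by simpa using hy) (by simp) (by simp) (by simp)]
    simp [hx, hy]

end

def NN (b : Bool) (n : ℕ) : ℕ := if b then n else n + 1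

theorem rep_pre {s t : List ℕ} (hs : s = List.replicate s.length 0)
    (ht : t = List.replicate t.length 0) : s <+: t ∨ t <+: s := by
  rw [hs, ht]
  rcases le_total s.length t.length with h | h
  · left; exact ⟨List.replicate (t.length - s.length) 0, by rw [List.replicate_append_replicate]; congr; omega⟩
  · right; exact ⟨List.replicate (s.length - t.length) 0, by rw [List.replicate_append_replicate]; congr; omega⟩

theorem rep_pre' (c i j : ℕ) :
    (c :: List.replicate i 0) <+: (c :: List.replicate j 0) ∨
    (c :: List.replicate j 0) <+: (c :: List.replicate i 0) := by
  simp only [List.cons_prefix_cons, true_and]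
  exact rep_pre (by simp) (by simp)

theorem brn_iff {b n x} (hx : x ∈ FT b n) : Brn (FT b n) x ↔ ∃ i < NN b n, x = enc i [] := by
  constructor
  · rintro ⟨y, hy, z, hz, hxy, hxz, hyz, hzy⟩
    obtain ⟨i, g, hi, hA, rfl⟩ := hx
    obtain ⟨j, h, hj, hB, rfl⟩ := hy
    obtain ⟨l, f, hl, hC, rfl⟩ := hz
    rw [enc_prefix hA.vld hB.vld] at hxy
    rw [enc_prefix hA.vld hC.vld] at hxz
    by_contra hcon
    have same : j = l → h <+: f ∨ f <+: h → False := by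
      rintro rfl h
      rcases h with h | h
      · exact hyz (enc_pre_same.2 h)
      · exact hzy (enc_pre_same.2 h)
    by_cases hg : g = []
    · subst hg
      have hi' : NN b n ≤ i := by
        by_contra h; exact hcon ⟨i, by omega, rfl⟩
      cases b with
      | false => simp [NN] at hi'; omega
      | true =>
        simp [NN] at hi'
        refine same (by omega) ?_
        rcases hB with rfl | ⟨c, a, rfl, hc, -⟩
        · simp
        rcases hC with rfl | ⟨c', a', rfl, hc', -⟩
        · simp
        simp at hc hc'
        subst hc hc'
        exact rep_pre' _ _ _
    · simp [hg] at hxy hxz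
      refine same (by omega) ?_
      rcases hB with rfl | ⟨c, a, rfl, hc, -⟩
      · simp
      rcases hC with rfl | ⟨c', a', rfl, hc', -⟩
      · simp
      have : c = c' := by
        cases g with
        | nil => simp at hg
        | cons d g =>
          rw [List.cons_prefix_cons, List.cons_prefix_cons] at *
          rw [← hxy.2.1, ← hxz.2.1]
      subst this
      exact rep_pre' _ _ _
  · rintro ⟨i, hi, rfl⟩
    have v1 : Vld [1] := by rintro l h; cases h
    have v2 : Vld [2] := by rintro l h; cases h
    cases b with
    | true =>
      simp [NN] at hi
      refine ⟨enc i [1], mem_FT hi.le (Or.inr ⟨1, 0, rfl, by simp, by simp⟩), enc (i + 1) [],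
        mem_FT hi (Or.inl rfl), ?_⟩
      simp [enc_prefix v1 vld_nil, enc_prefix vld_nil v1, enc_prefix vld_nil vld_nil]
    | false =>
      simp [NN] at hi
      refine ⟨enc n [1], mem_FT le_rfl (Or.inr ⟨1, 0, rfl, by simp, by simp⟩), enc n [2],
        mem_FT le_rfl (Or.inr ⟨2, 0, rfl, by simp, by simp⟩), ?_⟩
      simp [enc_prefix v1 v2, enc_prefix v2 v1, enc_prefix vld_nil v1, enc_prefix vld_nil v2]
      omega

theorem enc_snoc (i : ℕ) : enc i [] ++ [0] = enc (i + 1) [] := by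
  simp [enc, List.replicate_succ']

theorem NN_le {b n i} (h : i < NN b n) : i ≤ n := by
  cases b <;> simp [NN] at h <;> omega

theorem par_iff {AP : Type} (L : MLogic AP) (b : Bool) (n : ℕ) (hn : 1 ≤ n) :
    L.KSat (KT AP b n) MSOL.par ↔ ∃ S ∈ L.dom (FT b n),
      (∀ i < NN b n, (Ful (FT b n) S (enc i []) ↔ Even i)) ∧ Odd (NN b n) := by
  have hN : 1 ≤ NN b n := by cases b <;> simp [NN]; omega
  have hmem : ∀ i < NN b n, enc i [] ∈ FT b n := fun i hi => mem_FT (NN_le hi) (Or.inl rfl)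
  have hroot : ([] : Node) = enc 0 [] := by simp [enc]
  rw [ksat_iff _ _ _ MSOL.par_sentence (fun _ => []) (fun _ => ∅), sat_par _ _ _ _ rfl]
  refine exists_congr fun S => and_congr_right fun hS => ?_
  change (∀ x ∈ FT b n, (∀ y ∈ FT b n, x <+: y) → Ful (FT b n) S x) ∧
    (∀ x ∈ FT b n, ∀ k, x ++ [k] ∈ FT b n → Brn (FT b n) x → Brn (FT b n) (x ++ [k]) →
      (Ful (FT b n) S x ↔ ¬ Ful (FT b n) S (x ++ [k]))) ∧
    (∀ x ∈ FT b n, Brn (FT b n) x → (∀ y ∈ FT b n, Brn (FT b n) y → y <+: x) →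
      Ful (FT b n) S x) ↔ _
  constructor
  · rintro ⟨h1, h2, h3⟩
    have key : ∀ i < NN b n, (Ful (FT b n) S (enc i []) ↔ Even i) := by
      intro i
      induction i with
      | zero =>
        intro hi
        simp only [Even.zero, iff_true]
        exact h1 _ (hmem 0 hi) (by simp [enc])
      | succ i ih =>
        intro hi
        have ih := ih (by omega)
        have := h2 _ (hmem i (by omega)) 0 (by rw [enc_snoc]; exact hmem _ hi)
          ((brn_iff (hmem i (by omega))).2 ⟨i, by omega, rfl⟩)
          (by rw [enc_snoc]; exact (brn_iff (hmem _ hi)).2 ⟨_, hi, rfl⟩)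
        rw [enc_snoc] at this
        rw [Nat.even_add_one, ← ih, this, not_not]
    refine ⟨key, ?_⟩
    have hl : NN b n - 1 < NN b n := by omega
    have := h3 _ (hmem _ hl) ((brn_iff (hmem _ hl)).2 ⟨_, hl, rfl⟩) ?_
    · rw [key _ hl] at this
      have h5 := this.add_one
      rwa [Nat.sub_add_cancel hN] at h5
    · intro y hy hb
      obtain ⟨j, hj, rfl⟩ := (brn_iff hy).1 hb
      rw [enc_prefix vld_nil vld_nil]
      left; exact ⟨rfl, by omega⟩
  · rintro ⟨h1, h2⟩
    refine ⟨?_, ?_, ?_⟩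
    · intro x hx h
      have : x = [] := by simpa using h _ (FT_rooted b n).1
      rw [this, hroot, h1 _ (by omega)]
      simp
    · intro x hx k hk hb hb'
      obtain ⟨i, hi, rfl⟩ := (brn_iff hx).1 hb
      obtain ⟨j, hj, e⟩ := (brn_iff hk).1 hb'
      have hji : j = i + 1 := by
        have := congrArg List.length e
        simp [enc] at this
        omega
      subst hji
      rw [e, h1 _ hi, h1 _ hj, Nat.even_add_one, not_not]
    · intro x hx hb h
      obtain ⟨i, hi, rfl⟩ := (brn_iff hx).1 hb
      have hl : NN b n - 1 < NN b n := by omega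
      have := h _ (hmem _ hl) ((brn_iff (hmem _ hl)).2 ⟨_, hl, rfl⟩)
      rw [enc_prefix vld_nil vld_nil] at this
      have : i = NN b n - 1 := by omega
      rw [h1 _ hi, this]
      have h2' : Odd (NN b n - 1 + 1) := by rwa [Nat.sub_add_cancel hN]
      rw [Nat.odd_add_one] at h2'
      simpa using h2'

theorem par_mso {AP : Type} (n : ℕ) (hn : 1 ≤ n) :
    (MSO AP).KSat (KT AP false n) MSOL.par ↔ Odd (n + 1) := by
  rw [par_iff _ _ _ hn]
  constructor
  · rintro ⟨S, -, -, h⟩; exact h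
  · intro h
    refine ⟨{x ∈ FT false n | Odd x.length}, fun x hx => hx.1, ?_, h⟩
    intro i hi
    have hle := NN_le hi
    obtain ⟨k, hk⟩ := FT_nb false n _ (mem_FT (b := false) hle (Or.inl rfl))
    constructor
    · intro h
      have := (h k hk).2
      simp [enc, Nat.odd_add_one] at this
      simpa using this
    · intro h k hk
      refine ⟨hk, ?_⟩
      simpa [enc] using h.add_one

theorem par_mtl {AP : Type} (n : ℕ) (hn : 1 ≤ n) :
    (MTL AP).KSat (KT AP true n) MSOL.par ↔ Odd n := by
  rw [par_iff _ _ _ hn]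
  constructor
  · rintro ⟨S, -, -, h⟩; exact h
  · intro h
    refine ⟨{x | ∃ i g, i ≤ n ∧ Adm true n i g ∧ x = enc i g ∧ (g = [] ∨ Even i)}, ⟨?_, [], ?_⟩, ?_, h⟩
    · rintro x ⟨i, g, h1, h2, h3, -⟩; exact ⟨i, g, h1, h2, h3⟩
    · rw [treeRooted_iff]
      refine ⟨⟨0, [], by simp, Or.inl rfl, by simp [enc], Or.inl rfl⟩, by simp, ?_⟩
      rintro x ⟨i, g, h1, h2, rfl, h4⟩ y - hy
      rcases prefix_enc hy with ⟨j, hj, rfl⟩ | ⟨g', hg, rfl⟩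
      · exact ⟨j, [], by omega, Or.inl rfl, rfl, Or.inl rfl⟩
      · refine ⟨i, g', h1, h2.pre hg, rfl, ?_⟩
        rcases h4 with rfl | h4
        · left; simpa using hg
        · exact Or.inr h4
    · intro i hi
      have hle := NN_le hi
      have hA : Adm true n i [1] := Or.inr ⟨1, 0, rfl, by simp, by simp⟩
      constructor
      · intro h
        obtain ⟨j, g, h1, h2, h3, h4⟩ := h 1 (by rw [← enc_append]; exact mem_FT hle hA)
        rw [← enc_append] at h3
        obtain ⟨rfl, rfl⟩ := enc_inj hA.vld h2.vld h3
        simpa using h4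
      · intro h k hk
        obtain ⟨j, g, h1, h2, h3⟩ := hk
        refine ⟨j, g, h1, h2, h3, ?_⟩
        by_cases hg : g = []
        · exact Or.inl hg
        · right
          have : enc i [] <+: enc j g := by rw [← h3]; simp
          have hl := congrArg List.length h3
          have h5 := (enc_prefix vld_nil h2.vld i j).1 this
          have : 0 < g.length := List.length_pos_of_ne_nil hg
          simp [enc] at hl
          have : j = i := by omega
          rwa [this]

theorem not_leq {AP : Type} (b : Bool) (L : MLogic AP) (hs : ∀ φ, L.syn φ)
    (hp : ∀ n, 1 ≤ n → (L.KSat (KT AP b n) MSOL.par ↔ Odd (NN b n))) :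
    ¬ MLogic.Leq (finBrKT AP) L ⟨fun _ => True, Dm b⟩ := by
  intro h
  obtain ⟨φ, hφ, -, he⟩ := h MSOL.par MSOL.par_sentence (hs _)
  have hpos : 1 ≤ 2 ^ φ.qd := Nat.one_le_two_pow
  have h1 := he (KT AP b (2 ^ φ.qd)) (FT_fb _ _)
  have h2 := he (KT AP b (2 ^ φ.qd + 1)) (FT_fb _ _)
  rw [ksat_game b φ hφ le_rfl (Nat.le_succ _), ← h2, hp _ hpos, hp _ (by omega)] at h1
  have : NN b (2 ^ φ.qd + 1) = NN b (2 ^ φ.qd) + 1 := by cases b <;> simp [NN]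
  rw [this, Nat.odd_add_one] at h1
  tauto

/-- over finitely-branching Kripke trees, MPL < MTL < MSO. -/
theorem stmt4 (AP : Type) [Fintype AP] :
    MLogic.Lt (finBrKT AP) (MPL AP) (MTL AP) ∧
    MLogic.Lt (finBrKT AP) (MTL AP) (MSO AP) := by
  refine ⟨⟨mpl_leq_mtl AP _, ?_⟩, ⟨mtl_leq_mso AP _, ?_⟩⟩
  · exact not_leq true (MTL AP) (fun _ => trivial) (fun n hn => par_mtl n hn)
  · exact not_leq false (MSO AP) (fun _ => trivial) (fun n hn => par_mso n hn)
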